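/- arXiv:2206.09453 — 3 statements merged into one kernel-verified Lean document; each statement's English description precedes it below -/
import Mathlib

section
/- Let f : ℝ → ℝ be concave on a convex set D ⊆ ℝ, let k ≥ 1, and let x₁, …, x_{k+1} ∈ D. Then f((1/(k+1))·∑_{i=1}^{k+1} xᵢ) ≥ (1/(k+1))·∑_{i=1}^{k+1} f((1/k)·∑_{j≠i} x_j), where the inner sum runs over all j ∈ {1, …, k+1} with j ≠ i. -/
open Finset

/-- The key pointwise concavity inequality from the proof of Theorem 3.3: the value of a
concave `f` at the average of `k+1` points dominates the average of the values of `f` at the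
`k+1` leave-one-out averages. -/
theorem concave_leave_one_out_average
    (D : Set ℝ) (f : ℝ → ℝ) (hf : ConcaveOn ℝ D f)
    (k : ℕ) (hk : 1 ≤ k)
    (x : Fin (k + 1) → ℝ) (hx : ∀ i, x i ∈ D) :
    f ((1 / ((k : ℝ) + 1)) * ∑ i, x i) ≥
      (1 / ((k : ℝ) + 1)) *
        ∑ i, f ((1 / (k : ℝ)) * ∑ j ∈ Finset.univ.erase i, x j) := by
  have hk0 : (k : ℝ) ≠ 0 := by exact_mod_cast Nat.one_le_iff_ne_zero.mp hk
  have hk1 : (k : ℝ) + 1 ≠ 0 := by positivity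
  have hmem : ∀ i, (1 / (k : ℝ)) * ∑ j ∈ Finset.univ.erase i, x j ∈ D := by
    intro i
    rw [Finset.mul_sum]
    refine hf.1.sum_mem (w := fun _ => 1 / (k : ℝ)) (fun _ _ => by positivity) ?_
      (fun j _ => hx j)
    simp [Finset.card_erase_of_mem, hk0]
  have hsum : ∑ i, ∑ j ∈ Finset.univ.erase i, x j = k * ∑ i, x i := by
    simp only [Finset.sum_erase_eq_sub (Finset.mem_univ _), Finset.sum_sub_distrib,
      Finset.sum_const, Finset.card_univ, Fintype.card_fin, nsmul_eq_mul]
    push_cast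
    ring
  have havg : ∑ i, (1 / ((k : ℝ) + 1)) * ((1 / (k : ℝ)) * ∑ j ∈ Finset.univ.erase i, x j) =
      (1 / ((k : ℝ) + 1)) * ∑ i, x i := by
    rw [← Finset.mul_sum, ← Finset.mul_sum, hsum]
    field_simp
  have hjensen := hf.le_map_sum (t := Finset.univ) (w := fun _ => 1 / ((k : ℝ) + 1))
    (fun _ _ => by positivity) (by simp [hk1]) (fun i _ => hmem i)
  simp only [smul_eq_mul] at hjensen
  rwa [havg, ← Finset.mul_sum] at hjensen
end

section
/- Let g : (0, ∞) → ℝ be an arbitrary function, and let X and Y be independent, identically distributed real random variables on a probability space (Ω, μ) which are almost surely strictly positive, such that X, g(X), and exp(−g(X) − 1) are integrable. Then log 𝔼[X] ≤ 𝔼[g(X)] + 𝔼[Y]·𝔼[exp(−g(X) − 1)], i.e. log 𝔼[X] ≤ 𝔼[g(X) + Y·exp(−g(X) − 1)]. -/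
open MeasureTheory ProbabilityTheory

/-- **Theorem 3.7.** For an arbitrary function `g` and iid a.s. positive `X, Y`:
`log 𝔼 X ≤ 𝔼 g(X) + 𝔼 Y · 𝔼 exp(−g(X) − 1)`. -/
theorem log_mean_le_g_bound
    (g : ℝ → ℝ)
    {Ω : Type*} [MeasurableSpace Ω] (μ : Measure Ω) [IsProbabilityMeasure μ]
    (X Y : Ω → ℝ)
    (hindep : IndepFun X Y μ)
    (hid : IdentDistrib X Y μ μ)
    (hXpos : ∀ᵐ ω ∂μ, 0 < X ω)
    (hYpos : ∀ᵐ ω ∂μ, 0 < Y ω)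
    (hX : Integrable X μ)
    (hgX : Integrable (fun ω => g (X ω)) μ)
    (hexp : Integrable (fun ω => Real.exp (-g (X ω) - 1)) μ) :
    Real.log (∫ ω, X ω ∂μ) ≤
      (∫ ω, g (X ω) ∂μ) + (∫ ω, Y ω ∂μ) * (∫ ω, Real.exp (-g (X ω) - 1) ∂μ) := by
  have hpos : 0 < ∫ ω, X ω ∂μ := by
    rw [integral_pos_iff_support_of_nonneg_ae (hXpos.mono fun _ h => h.le) hX]
    have hsupp : Function.support X =ᵐ[μ] Set.univ :=
      Filter.eventuallyEq_univ.mpr (hXpos.mono fun _ h => h.ne')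
    simp [measure_congr hsupp]
  rw [← hid.integral_eq]
  set a := ∫ ω, X ω ∂μ
  have hpt : ∀ ω, Real.log a ≤ g (X ω) + a * Real.exp (-g (X ω) - 1) := by
    intro ω
    have h := Real.add_one_le_exp (Real.log a + (-g (X ω) - 1))
    rw [Real.exp_add, Real.exp_log hpos] at h
    linarith
  calc Real.log a = ∫ _, Real.log a ∂μ := by simp
    _ ≤ ∫ ω, (g (X ω) + a * Real.exp (-g (X ω) - 1)) ∂μ :=
      integral_mono (integrable_const _) (hgX.add (hexp.const_mul a)) hpt
    _ = _ := by rw [integral_add hgX (hexp.const_mul a), integral_const_mul]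
end

section
/- Let ε > 0, m ∈ ℝ, and let f : ℝ → ℝ be three times differentiable on the interval [m − ε, m + ε] with |f'''(t)| ≤ M for all t ∈ [m − ε, m + ε]. Let X and Y be independent, identically distributed real random variables on a probability space (Ω, μ) taking values in [m − ε, m + ε] almost surely and satisfying 𝔼[X] = m. Then |f(𝔼[X]) − 𝔼[f(X)] − (1/2)·𝔼[(Y − X)·f'(X)]| ≤ M·ε³. -/
open MeasureTheory ProbabilityTheory

/-- A function continuous on a compact interval agrees there with a globally continuous one. -/
lemma exists_continuous_eqOn_Icc {a b : ℝ} (hab : a ≤ b) {f : ℝ → ℝ}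
    (hf : ContinuousOn f (Set.Icc a b)) :
    ∃ F : ℝ → ℝ, Continuous F ∧ Set.EqOn f F (Set.Icc a b) :=
  ⟨Set.IccExtend hab ((Set.Icc a b).domRestrict f), hf.domRestrict.Icc_extend',
    fun _ hx => (Set.IccExtend_of_mem hab ((Set.Icc a b).domRestrict f) hx).symm⟩

/-- A continuous function of a random variable with values in a compact interval is integrable. -/
lemma Continuous.integrable_comp_of_mem_Icc {Ω : Type*} [MeasurableSpace Ω] {μ : Measure Ω}
    [IsFiniteMeasure μ] {a b : ℝ} {F : ℝ → ℝ} (hF : Continuous F) {X : Ω → ℝ}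
    (hXm : AEMeasurable X μ) (hX : ∀ᵐ ω ∂μ, X ω ∈ Set.Icc a b) :
    Integrable (fun ω => F (X ω)) μ := by
  obtain ⟨C, hC⟩ := isCompact_Icc.exists_bound_of_continuousOn (hF.continuousOn (s := Set.Icc a b))
  refine Integrable.of_bound (hF.measurable.comp_aemeasurable hXm).aestronglyMeasurable C ?_
  filter_upwards [hX] with ω hω using hC _ hω

/-- Error of the trapezoidal rule for `f'`, corrected by a term linear in `m - x`. -/
lemma abs_trapezoid_error_le {ε m M : ℝ} (hε : 0 < ε) {f f' f'' f''' : ℝ → ℝ}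
    (h1 : ∀ t ∈ Set.Icc (m - ε) (m + ε), HasDerivAt f (f' t) t)
    (h2 : ∀ t ∈ Set.Icc (m - ε) (m + ε), HasDerivAt f' (f'' t) t)
    (h3 : ∀ t ∈ Set.Icc (m - ε) (m + ε), HasDerivAt f'' (f''' t) t)
    (hM : ∀ t ∈ Set.Icc (m - ε) (m + ε), |f''' t| ≤ M)
    {x : ℝ} (hx : x ∈ Set.Icc (m - ε) (m + ε)) :
    |f m - f x - (1 / 2) * ((m - x) * f' x) - (1 / 2) * f' m * (m - x)| ≤ M * ε ^ 3 := by
  have hm : m ∈ Set.Icc (m - ε) (m + ε) := ⟨by linarith, by linarith⟩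
  have hM0 : 0 ≤ M := (abs_nonneg _).trans (hM m hm)
  have hdist : ∀ t ∈ Set.Icc (m - ε) (m + ε), |t - m| ≤ ε := fun t ht =>
    abs_le.2 ⟨by linarith [ht.1], by linarith [ht.2]⟩
  have hr : ∀ t ∈ Set.Icc (m - ε) (m + ε), |f' m - f' t - (m - t) * f'' t| ≤ M * ε ^ 2 := by
    intro t ht
    have key := (convex_Icc (m - ε) (m + ε)).norm_image_sub_le_of_norm_hasDerivWithin_le
      (f := fun s => f' m - f' s - (m - s) * f'' s)
      (f' := fun s => -((m - s) * f''' s)) (C := M * ε) (x := m) (y := t)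
      (fun s hs => by
        have h := (((h2 s hs).const_sub (f' m)).sub
          (((hasDerivAt_id' s).const_sub m).mul (h3 s hs)))
        refine (h.congr_deriv ?_).hasDerivWithinAt
        ring)
      (fun s hs => by
        rw [Real.norm_eq_abs, abs_neg, abs_mul, abs_sub_comm, mul_comm]
        exact mul_le_mul (hM s hs) (hdist s hs) (abs_nonneg _) hM0)
      hm ht
    simp only [Real.norm_eq_abs, sub_self, zero_mul, sub_zero] at key
    calc _ ≤ M * ε * |t - m| := key
      _ ≤ M * ε * ε := by gcongr; exact hdist t ht
      _ = M * ε ^ 2 := by ring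
  have key := (convex_Icc (m - ε) (m + ε)).norm_image_sub_le_of_norm_hasDerivWithin_le
    (f := fun s => f m - f s - (1 / 2) * ((m - s) * f' s) - (1 / 2) * f' m * (m - s))
    (f' := fun s => (1 / 2) * (f' m - f' s - (m - s) * f'' s)) (C := M * ε ^ 2) (x := m) (y := x)
    (fun s hs => by
      have hs' := (hasDerivAt_id' s).const_sub m
      have h := (((h1 s hs).const_sub (f m)).sub ((hs'.mul (h2 s hs)).const_mul (1 / 2))).sub
        (hs'.const_mul ((1 / 2) * f' m))
      refine (h.congr_deriv ?_).hasDerivWithinAt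
      ring)
    (fun s hs => by
      rw [Real.norm_eq_abs, abs_mul, abs_of_pos (by norm_num : (0 : ℝ) < 1 / 2)]
      linarith [hr s hs, abs_nonneg (f' m - f' s - (m - s) * f'' s)])
    hm hx
  simp only [Real.norm_eq_abs, sub_self, zero_mul, mul_zero, sub_zero] at key
  calc _ ≤ M * ε ^ 2 * |x - m| := key
    _ ≤ M * ε ^ 2 * ε := by gcongr; exact hdist x hx
    _ = M * ε ^ 3 := by ring

/-- **Theorem 3.10 (quantitative form).** If `f` is three times differentiable on
`[m − ε, m + ε]` with `|f'''| ≤ M` there, and `X, Y` are iid with values in `[m − ε, m + ε]`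
a.s. and `𝔼 X = m`, then `f(𝔼 X) = 𝔼 f(X) + ½ 𝔼((Y − X) f'(X))` up to an error of size
at most `M ε³`. -/
theorem middle_point_approximation
    (ε : ℝ) (hε : 0 < ε) (m M : ℝ)
    (f f' f'' f''' : ℝ → ℝ)
    (h1 : ∀ t ∈ Set.Icc (m - ε) (m + ε), HasDerivAt f (f' t) t)
    (h2 : ∀ t ∈ Set.Icc (m - ε) (m + ε), HasDerivAt f' (f'' t) t)
    (h3 : ∀ t ∈ Set.Icc (m - ε) (m + ε), HasDerivAt f'' (f''' t) t)
    (hM : ∀ t ∈ Set.Icc (m - ε) (m + ε), |f''' t| ≤ M)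
    {Ω : Type*} [MeasurableSpace Ω] (μ : Measure Ω) [IsProbabilityMeasure μ]
    (X Y : Ω → ℝ)
    (hindep : IndepFun X Y μ)
    (hid : IdentDistrib X Y μ μ)
    (hX : ∀ᵐ ω ∂μ, X ω ∈ Set.Icc (m - ε) (m + ε))
    (hY : ∀ᵐ ω ∂μ, Y ω ∈ Set.Icc (m - ε) (m + ε))
    (hmean : (∫ ω, X ω ∂μ) = m) :
    |f (∫ ω, X ω ∂μ) - (∫ ω, f (X ω) ∂μ)
        - (1 / 2) * ∫ ω, (Y ω - X ω) * f' (X ω) ∂μ| ≤ M * ε ^ 3 := by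
  have hab : m - ε ≤ m + ε := by linarith
  obtain ⟨F, hF, hfF⟩ := exists_continuous_eqOn_Icc hab
    (fun t ht => (h1 t ht).continuousAt.continuousWithinAt)
  obtain ⟨G, hG, hfG⟩ := exists_continuous_eqOn_Icc hab
    (fun t ht => (h2 t ht).continuousAt.continuousWithinAt)
  have hXm := hid.aemeasurable_fst
  have hYm := hid.aemeasurable_snd
  have iX : Integrable X μ := continuous_id.integrable_comp_of_mem_Icc hXm hX
  have iF := hF.integrable_comp_of_mem_Icc hXm hX
  have iG := hG.integrable_comp_of_mem_Icc hXm hX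
  have iXG : Integrable (fun ω => X ω * G (X ω)) μ :=
    (continuous_id.mul hG).integrable_comp_of_mem_Icc hXm hX
  have iY : Integrable Y μ := continuous_id.integrable_comp_of_mem_Icc hYm hY
  have hYG : IndepFun Y (fun ω => G (X ω)) μ := hindep.symm.comp measurable_id hG.measurable
  have iYG : Integrable (fun ω => Y ω * G (X ω)) μ := hYG.integrable_mul iY iG
  have eYG : ∫ ω, Y ω * G (X ω) ∂μ = m * ∫ ω, G (X ω) ∂μ := by
    rw [hYG.integral_fun_mul_eq_mul_integral iY.aestronglyMeasurable iG.aestronglyMeasurable,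
      ← hid.integral_eq, hmean]
  have e1 : ∫ ω, f (X ω) ∂μ = ∫ ω, F (X ω) ∂μ :=
    integral_congr_ae (by filter_upwards [hX] with ω hω using hfF hω)
  have e2 : ∫ ω, (Y ω - X ω) * f' (X ω) ∂μ
      = m * (∫ ω, G (X ω) ∂μ) - ∫ ω, X ω * G (X ω) ∂μ := by
    rw [← eYG, ← integral_sub iYG iXG]
    refine integral_congr_ae ?_
    filter_upwards [hX] with ω hω
    rw [hfG hω, sub_mul]
  have e3 : f m - (∫ ω, F (X ω) ∂μ)
      - (1 / 2) * (m * (∫ ω, G (X ω) ∂μ) - ∫ ω, X ω * G (X ω) ∂μ)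
      = ∫ ω, (f m - F (X ω) - (1 / 2) * (m * G (X ω) - X ω * G (X ω))
          - (1 / 2) * f' m * (m - X ω)) ∂μ := by
    have iL : Integrable (fun ω => (1 / 2) * (m * G (X ω) - X ω * G (X ω))) μ :=
      ((iG.const_mul m).sub iXG).const_mul _
    have iD : Integrable (fun ω => f m - F (X ω)) μ := (integrable_const _).sub iF
    have iC : Integrable (fun ω => (1 / 2) * f' m * (m - X ω)) μ :=
      ((integrable_const m).sub iX).const_mul _
    have iDL : Integrable (fun ω => f m - F (X ω)
        - (1 / 2) * (m * G (X ω) - X ω * G (X ω))) μ := iD.sub iL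
    rw [integral_sub iDL iC, integral_sub iD iL, integral_sub (integrable_const _) iF,
      integral_const_mul, integral_const_mul, integral_sub (iG.const_mul m) iXG,
      integral_const_mul, integral_sub (integrable_const m) iX, hmean]
    simp
  rw [hmean, e1, e2, e3, ← Real.norm_eq_abs]
  refine (norm_integral_le_of_norm_le_const (C := M * ε ^ 3) ?_).trans (by simp)
  filter_upwards [hX] with ω hω
  rw [← hfF hω, ← hfG hω, ← sub_mul, Real.norm_eq_abs]
  exact abs_trapezoid_error_le hε h1 h2 h3 hM hω
end
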